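/- arXiv:1801.06779 — 2 statements merged into one kernel-verified Lean document; each statement's English description precedes it below -/
import Mathlib

section
/- Let F be a field and let M and M' be nontrivial Puiseux monoids such that both Puiseux algebras F[M] and F[M'] are half-factorial domains. Then F[M] and F[M'] are isomorphic as F-algebras (indeed both are isomorphic to the polynomial ring F[X]). -/
/-- A Puiseux monoid: an additive submonoid of `ℚ` all of whose elements are nonnegative. -/
def IsPuiseuxMonoid (M : AddSubmonoid ℚ) : Prop := ∀ x ∈ M, 0 ≤ x

/-- An integral domain is half-factorial if it is atomic and any two factorizations of the same
element into irreducibles have the same length. -/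
def IsHalfFactorial (R : Type*) [CommMonoidWithZero R] : Prop :=
  (∀ f : R, f ≠ 0 → ¬ IsUnit f →
      ∃ s : Multiset R, (∀ g ∈ s, Irreducible g) ∧ s.prod = f) ∧
    ∀ s t : Multiset R, (∀ g ∈ s, Irreducible g) → (∀ g ∈ t, Irreducible g) →
      s.prod = t.prod → Multiset.card s = Multiset.card t

namespace AddMonoidAlgebra

/-- Over a domain, the factors of a nonzero monomial are monomials when the exponents have two
unique sums. -/
lemma exists_eq_single_of_mul_eq_single {R A : Type*} [Semiring R] [NoZeroDivisors R] [Add A]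
    [TwoUniqueSums A] {f g : AddMonoidAlgebra R A} {m : A} {c : R} (hc : c ≠ 0)
    (h : f * g = single m c) :
    ∃ a d b e, f = single a d ∧ g = single b e ∧ d ≠ 0 ∧ e ≠ 0 ∧ a + b = m := by
  classical
  have hm : single m c ≠ 0 := by simpa using hc
  have hf : f ≠ 0 := by rintro rfl; exact hm (by rw [← h, zero_mul])
  have hg : g ≠ 0 := by rintro rfl; exact hm (by rw [← h, mul_zero])
  have hf' : 0 < f.coeff.support.card := by simpa [Finset.card_pos] using hf
  have hg' : 0 < g.coeff.support.card := by simpa [Finset.card_pos] using hg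
  have key : ∀ a ∈ f.coeff.support, ∀ b ∈ g.coeff.support,
      UniqueAdd f.coeff.support g.coeff.support a b → a + b = m := by
    intro a ha b hb hu
    have hab := coeff_mul_add_of_uniqueAdd hu
    rw [h, coeff_single, Finsupp.single_apply] at hab
    by_contra hne
    rw [if_neg (Ne.symm hne)] at hab
    exact mul_ne_zero (Finsupp.mem_support_iff.mp ha) (Finsupp.mem_support_iff.mp hb) hab.symm
  have hcard : ¬ 1 < f.coeff.support.card * g.coeff.support.card := by
    intro hlt
    obtain ⟨p, hp, q, hq, hpq, hup, huq⟩ := TwoUniqueSums.uniqueAdd_of_one_lt_card hlt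
    rw [Finset.mem_product] at hp hq
    have hsum := (key _ hq.1 _ hq.2 huq).trans (key _ hp.1 _ hp.2 hup).symm
    have heq := hup hq.1 hq.2 hsum
    exact hpq (Prod.ext heq.1.symm heq.2.symm)
  have hf1 : f.coeff.support.card = 1 := by nlinarith
  have hg1 : g.coeff.support.card = 1 := by nlinarith
  obtain ⟨a, d, hd, hfa⟩ := Finsupp.card_support_eq_one'.mp hf1
  obtain ⟨b, e, he, hgb⟩ := Finsupp.card_support_eq_one'.mp hg1
  have hfs : f = single a d := by ext; simp [hfa]
  have hgs : g = single b e := by ext; simp [hgb]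
  refine ⟨a, d, b, e, hfs, hgs, hd, he, ?_⟩
  rw [hfs, hgs, single_mul_single] at h
  by_contra hne
  have hm0 := congrArg (fun u => u.coeff m) h
  simp [hne] at hm0
  exact hc hm0.symm

lemma irreducible_single_one {F A : Type*} [Field F] [AddCommMonoid A] {a : A} {c : F}
    (hc : c ≠ 0) (h : Irreducible (single a c)) : Irreducible (single a (1 : F)) := by
  have hu : IsUnit (single (0 : A) c⁻¹) :=
    IsUnit.of_mul_eq_one (single (0 : A) c) (by simp [single_mul_single, one_def, hc])
  have hmul : single a (1 : F) = single (0 : A) c⁻¹ * single a c := by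
    simp [single_mul_single, hc]
  rw [hmul]
  exact (irreducible_isUnit_mul hu).mpr h

lemma exists_sum_eq_of_prod_eq_single {F A : Type*} [Field F] [AddCommMonoid A] [TwoUniqueSums A]
    (s : Multiset (AddMonoidAlgebra F A)) (hs : ∀ g ∈ s, Irreducible g) (x : A) (c : F)
    (hc : c ≠ 0) (h : s.prod = single x c) :
    ∃ t : Multiset A, (∀ a ∈ t, Irreducible (single a (1 : F))) ∧ t.sum = x := by
  induction s using Multiset.induction_on generalizing x c with
  | empty =>
    refine ⟨0, by simp, ?_⟩
    rw [Multiset.prod_zero, one_def] at h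
    by_contra hne
    have hx := congrArg (fun u => u.coeff x) h
    rw [Multiset.sum_zero] at hne
    simp [hne] at hx
    exact hc hx.symm
  | cons g s ih =>
    rw [Multiset.prod_cons] at h
    obtain ⟨a, d, b, e, rfl, hb, hd, he, rfl⟩ := exists_eq_single_of_mul_eq_single hc h
    obtain ⟨t, ht, rfl⟩ := ih (fun g hg => hs g (Multiset.mem_cons_of_mem hg)) b e he hb
    refine ⟨a ::ₘ t, ?_, Multiset.sum_cons a t⟩
    intro y hy
    rcases Multiset.mem_cons.mp hy with rfl | hy
    · exact irreducible_single_one hd (hs _ (Multiset.mem_cons_self _ _))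
    · exact ht y hy

end AddMonoidAlgebra

open AddMonoidAlgebra in
/-- Two irreducible monomials of a half-factorial Puiseux algebra coincide. -/
lemma IsHalfFactorial.eq_of_irreducible_single {F : Type*} [Field F] {M : AddSubmonoid ℚ}
    (hM : IsPuiseuxMonoid M) (h : IsHalfFactorial (AddMonoidAlgebra F M)) {a b : M}
    (ha : Irreducible (single a (1 : F))) (hb : Irreducible (single b (1 : F))) : a = b := by
  have hpos : ∀ x : M, Irreducible (single x (1 : F)) → 0 < (x : ℚ) := by
    intro x hx
    refine lt_of_le_of_ne (hM x x.2) fun h0 => hx.not_isUnit ?_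
    have hx0 : x = 0 := Subtype.ext h0.symm
    rw [hx0, ← one_def]
    exact isUnit_one
  have num_eq : ∀ x : M, 0 < (x : ℚ) →
      (((x : ℚ).num.natAbs : ℕ) : ℚ) = (x : ℚ) * (x : ℚ).den := by
    intro x hx
    rw [Rat.mul_den_eq_num, Nat.cast_natAbs, abs_of_pos (Rat.num_pos.mpr hx)]
  have hna := num_eq a (hpos a ha)
  have hnb := num_eq b (hpos b hb)
  have hsmul : ((b : ℚ).num.natAbs * (a : ℚ).den) • a = ((a : ℚ).num.natAbs * (b : ℚ).den) • b := by
    apply Subtype.ext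
    simp only [AddSubmonoidClass.coe_nsmul, nsmul_eq_mul, Nat.cast_mul, hna, hnb]
    ring
  have hcard := h.2 (Multiset.replicate ((b : ℚ).num.natAbs * (a : ℚ).den) (single a (1 : F)))
    (Multiset.replicate ((a : ℚ).num.natAbs * (b : ℚ).den) (single b (1 : F)))
    (fun g hg => Multiset.eq_of_mem_replicate hg ▸ ha)
    (fun g hg => Multiset.eq_of_mem_replicate hg ▸ hb)
    (by simp only [Multiset.prod_replicate, single_pow, one_pow, hsmul])
  simp only [Multiset.card_replicate] at hcard
  have hq : ((b : ℚ).num.natAbs : ℚ) * (a : ℚ).den = ((a : ℚ).num.natAbs : ℚ) * (b : ℚ).den := by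
    exact_mod_cast hcard
  rw [hna, hnb] at hq
  have hda : ((a : ℚ).den : ℚ) ≠ 0 := by exact_mod_cast (a : ℚ).den_nz
  have hdb : ((b : ℚ).den : ℚ) ≠ 0 := by exact_mod_cast (b : ℚ).den_nz
  apply Subtype.ext
  apply mul_right_cancel₀ (mul_ne_zero hda hdb)
  linear_combination -hq

open AddMonoidAlgebra in
/-- A nontrivial Puiseux monoid with half-factorial algebra is isomorphic to `ℕ`. -/
lemma IsHalfFactorial.nonempty_addEquiv_nat {F : Type*} [Field F] {M : AddSubmonoid ℚ}
    (hM : IsPuiseuxMonoid M) (hnt : M ≠ ⊥) (h : IsHalfFactorial (AddMonoidAlgebra F M)) :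
    Nonempty (ℕ ≃+ M) := by
  have hsum : ∀ x : M, x ≠ 0 →
      ∃ t : Multiset M, (∀ a ∈ t, Irreducible (single a (1 : F))) ∧ t.sum = x := by
    intro x hx
    have hnu : ¬ IsUnit (single x (1 : F)) := by
      intro hu
      obtain ⟨g, hg⟩ := hu.exists_right_inv
      rw [one_def] at hg
      obtain ⟨a, d, b, e, ha, -, hd, -, hab⟩ := exists_eq_single_of_mul_eq_single one_ne_zero hg
      have hxa : x = a := by
        by_contra hne
        have hx0 := congrArg (fun u => u.coeff x) ha
        simp [Ne.symm hne] at hx0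
      subst hxa
      have hab' : (x : ℚ) + b = 0 := congrArg Subtype.val hab
      have hx0 := hM x x.2
      have hb0 := hM b b.2
      exact hx (Subtype.ext (by simpa using (by linarith : (x : ℚ) = 0)))
    obtain ⟨s, hs, hprod⟩ := h.1 (single x (1 : F)) (by simp) hnu
    exact exists_sum_eq_of_prod_eq_single s hs x 1 one_ne_zero hprod
  have := M.bot_or_nontrivial.resolve_left hnt
  obtain ⟨x, hx⟩ := exists_ne (0 : M)
  obtain ⟨t, ht, htx⟩ := hsum x hx
  obtain ⟨a, hat⟩ : ∃ a, a ∈ t := by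
    apply Multiset.exists_mem_of_ne_zero
    rintro rfl
    exact hx htx.symm
  have ha := ht a hat
  have ha0 : a ≠ 0 := by
    rintro rfl
    exact ha.not_isUnit (by rw [← one_def]; exact isUnit_one)
  refine ⟨AddEquiv.ofBijective (multiplesHom M a) ⟨?_, ?_⟩⟩
  · intro m n hmn
    have hmn' : (m : ℚ) * a = n * a := by simpa using congrArg Subtype.val hmn
    exact_mod_cast mul_right_cancel₀ (fun h0 => ha0 (Subtype.ext h0)) hmn'
  · intro y
    by_cases hy : y = 0
    · exact ⟨0, by simp [hy]⟩
    obtain ⟨u, hu, rfl⟩ := hsum y hy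
    refine ⟨Multiset.card u, ?_⟩
    conv_rhs => rw [Multiset.eq_replicate_card.mpr
      fun b hb => h.eq_of_irreducible_single hM (hu b hb) ha]
    simp

/-- A half-factorial algebra of a nontrivial Puiseux monoid is a polynomial ring. -/
lemma IsHalfFactorial.nonempty_algEquiv_polynomial {F : Type*} [Field F] {M : AddSubmonoid ℚ}
    (hM : IsPuiseuxMonoid M) (hnt : M ≠ ⊥) (h : IsHalfFactorial (AddMonoidAlgebra F M)) :
    Nonempty (AddMonoidAlgebra F M ≃ₐ[F] Polynomial F) := by
  obtain ⟨e⟩ := h.nonempty_addEquiv_nat hM hnt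
  exact ⟨(AddMonoidAlgebra.domCongr F F e.symm).trans (Polynomial.toFinsuppIsoAlg F).symm⟩

/-- If `F` is a field and `M`, `M'` are nontrivial Puiseux monoids whose Puiseux algebras
`F[M]` and `F[M']` are half-factorial, then `F[M] ≅ F[M']` as `F`-algebras; indeed both are
isomorphic to the polynomial ring `F[X]`. -/
theorem half_factorial_puiseux_algebras_isomorphic (F : Type*) [Field F]
    (M M' : AddSubmonoid ℚ) (hM : IsPuiseuxMonoid M) (hM' : IsPuiseuxMonoid M')
    (hMnt : M ≠ ⊥) (hM'nt : M' ≠ ⊥)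
    (h1 : IsHalfFactorial (AddMonoidAlgebra F M))
    (h2 : IsHalfFactorial (AddMonoidAlgebra F M')) :
    Nonempty (AddMonoidAlgebra F M ≃ₐ[F] AddMonoidAlgebra F M') ∧
      Nonempty (AddMonoidAlgebra F M ≃ₐ[F] Polynomial F) := by
  obtain ⟨e⟩ := h1.nonempty_algEquiv_polynomial hM hMnt
  obtain ⟨e'⟩ := h2.nonempty_algEquiv_polynomial hM' hM'nt
  exact ⟨⟨e.trans e'.symm⟩, ⟨e⟩⟩
end

section
/- A nontrivial root-closed Puiseux monoid M is antimatter if and only if 0 is a limit point of M, i.e., for every ε > 0 there exists x ∈ M with 0 < x < ε. -/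
/-- A Puiseux monoid `M` is root-closed if every `x ∈ ℚ` lying in the difference group of `M`
with `n • x ∈ M` for some positive integer `n` belongs to `M`. -/
def IsRootClosedPM (M : AddSubmonoid ℚ) : Prop :=
  ∀ x : ℚ, (∃ a ∈ M, ∃ b ∈ M, x = a - b) → (∃ n : ℕ, 0 < n ∧ (n : ℚ) * x ∈ M) → x ∈ M

/-- `a` is an atom of the Puiseux monoid `M`. -/
def IsAtomOf (M : AddSubmonoid ℚ) (a : ℚ) : Prop :=
  a ∈ M ∧ a ≠ 0 ∧ ∀ x ∈ M, ∀ y ∈ M, a = x + y → x = 0 ∨ y = 0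

/-- A Puiseux monoid is atomic if every element is a finite sum of atoms. -/
def IsAtomicPM (M : AddSubmonoid ℚ) : Prop :=
  ∀ x ∈ M, ∃ s : Multiset ℚ, (∀ a ∈ s, IsAtomOf M a) ∧ s.sum = x

/-- A Puiseux monoid is antimatter if it has no atoms. -/
def IsAntimatterPM (M : AddSubmonoid ℚ) : Prop := ¬ ∃ a : ℚ, IsAtomOf M a

/-- A root-closed Puiseux monoid contains every positive difference of two of its elements. -/
theorem IsRootClosedPM.sub_mem {M : AddSubmonoid ℚ} (hrc : IsRootClosedPM M) {a b : ℚ}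
    (ha : a ∈ M) (hb : b ∈ M) (h0 : 0 < b) (hba : b < a) : a - b ∈ M := by
  refine hrc _ ⟨a, ha, b, hb, rfl⟩ ⟨(a - b).den * b.num.toNat, ?_, ?_⟩
  · have := Rat.num_pos.2 h0
    exact Nat.mul_pos (a - b).den_pos (by omega)
  · have hn : ((b.num.toNat : ℕ) : ℚ) = b * b.den := by
      rw [Rat.mul_den_eq_num]
      exact_mod_cast Int.toNat_of_nonneg (Rat.num_pos.2 h0).le
    have hd : (((a - b).num.toNat : ℕ) : ℚ) = (a - b) * (a - b).den := by
      rw [Rat.mul_den_eq_num]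
      exact_mod_cast Int.toNat_of_nonneg (Rat.num_pos.2 (sub_pos.2 hba)).le
    have key : (((a - b).den * b.num.toNat : ℕ) : ℚ) * (a - b)
        = ((a - b).num.toNat * b.den) • b := by
      rw [nsmul_eq_mul]
      rw [Nat.cast_mul, Nat.cast_mul]
      rw [hn, hd]
      ring
    rw [key]
    exact M.nsmul_mem hb _

/-- An antimatter Puiseux monoid with no elements in `(0, ε)` has no positive elements. -/
theorem IsAntimatterPM.not_pos_of_gap {M : AddSubmonoid ℚ} (hM : IsPuiseuxMonoid M)
    (hanti : IsAntimatterPM M) {ε : ℚ} (hgap : ∀ x ∈ M, 0 < x → ε ≤ x) (n : ℕ) :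
    ∀ a ∈ M, 0 < a → ¬ a < n * ε + ε := by
  induction n with
  | zero =>
    intro a ha h0 hlt
    have := hgap a ha h0
    simp only [Nat.cast_zero, zero_mul, zero_add] at hlt
    linarith
  | succ n ih =>
    intro a ha h0 hlt
    refine hanti ⟨a, ha, h0.ne', fun x hx y hy hxy => ?_⟩
    by_contra! hne
    have hx0 := (hM x hx).lt_of_ne' hne.1
    have hy0 := (hM y hy).lt_of_ne' hne.2
    have hyε := hgap y hy hy0
    push_cast at hlt
    exact ih x hx hx0 (by linarith)

/-- A nontrivial root-closed Puiseux monoid is antimatter if and only if `0` is a limit point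
of `M`: for every `ε > 0` there is `x ∈ M` with `0 < x < ε`. -/
theorem rootClosed_antimatter_iff_zero_limitPoint (M : AddSubmonoid ℚ) (hM : IsPuiseuxMonoid M)
    (hMnt : M ≠ ⊥) (hrc : IsRootClosedPM M) :
    IsAntimatterPM M ↔ ∀ ε : ℚ, 0 < ε → ∃ x ∈ M, 0 < x ∧ x < ε := by
  constructor
  · intro hanti ε hε
    by_contra! hgap
    obtain ⟨m, hm, hm0⟩ := M.bot_or_exists_ne_zero.resolve_left hMnt
    obtain ⟨n, hn⟩ := exists_nat_gt (m / ε)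
    rw [div_lt_iff₀ hε] at hn
    exact hanti.not_pos_of_gap hM hgap n m hm ((hM m hm).lt_of_ne' hm0) (by linarith)
  · rintro hlim ⟨a, ha, ha0, hatom⟩
    obtain ⟨x, hx, hx0, hxa⟩ := hlim a ((hM a ha).lt_of_ne' ha0)
    rcases hatom x hx (a - x) (hrc.sub_mem ha hx hx0 hxa) (by ring) with h | h <;> linarith
end
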